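/- On a symplectic vector space (V, Ω) of dimension 2n, the contraction map ⊥: Λᵏ(V*) → Λᵏ⁻²(V*), ω ↦ i_{X_Ω}(ω), is injective for k ≥ n+1. -/

import Mathlib

/- Framework: exterior forms on a real vector space `V` are modelled as elements of the
exterior algebra of the dual space; a `k`-form is an element of the submodule
`⋀[ℝ]^k (Module.Dual ℝ V)`, and the wedge product is the algebra multiplication. -/

noncomputable section
open ExteriorAlgebra
set_option synthInstance.maxHeartbeats 1000000
set_option maxHeartbeats 1000000

variable (V : Type) [AddCommGroup V] [Module ℝ V]

/-- The algebra of exterior forms on `V`. -/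
abbrev EForm := ExteriorAlgebra ℝ (Module.Dual ℝ V)

variable {V}

/-- Interior product (contraction) of forms by a vector, linear in the vector. -/
def iContrL : V →ₗ[ℝ] Module.End ℝ (EForm V) :=
  (CliffordAlgebra.contractLeft (Q := (0 : QuadraticForm ℝ (Module.Dual ℝ V)))).comp
    (Module.Dual.eval ℝ V)

/-- Contraction of forms by an arbitrary element of the exterior algebra of `V`
(e.g. by a bivector), extending `iContrL` as an algebra morphism. -/
def aContr : ExteriorAlgebra ℝ V →ₐ[ℝ] Module.End ℝ (EForm V) :=
  ExteriorAlgebra.lift ℝ ⟨iContrL, fun _ =>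
    LinearMap.ext fun _ => CliffordAlgebra.contractLeft_contractLeft _ _⟩

/-- The bilinear form on `V` associated with an exterior 2-form, via double contraction
(the scalar part is extracted by `ExteriorAlgebra.algebraMapInv`). -/
def formToBilin (Om : EForm V) : V →ₗ[ℝ] V →ₗ[ℝ] ℝ :=
  LinearMap.mk₂ ℝ (fun x y => algebraMapInv (iContrL y (iContrL x Om)))
    (fun x x' y => by simp [map_add, LinearMap.add_apply])
    (fun c x y => by simp [map_smul, LinearMap.smul_apply])
    (fun x y y' => by simp [map_add, LinearMap.add_apply])
    (fun c x y => by simp [map_smul, LinearMap.smul_apply])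

/-- A 2-form is nondegenerate (symplectic) if its associated bilinear form is. -/
def IsSymplecticForm (Om : EForm V) : Prop :=
  Om ∈ ⋀[ℝ]^2 (Module.Dual ℝ V) ∧ ∀ x : V, (∀ y : V, formToBilin Om x y = 0) → x = 0

/-- The algebra morphism `⋀ V → ⋀ V*` induced by a linear map `Γ : V → V*`. -/
def extAlgMap (f : V →ₗ[ℝ] Module.Dual ℝ V) : ExteriorAlgebra ℝ V →ₐ[ℝ] EForm V :=
  ExteriorAlgebra.lift ℝ ⟨(ExteriorAlgebra.ι ℝ).comp f, fun _ => ι_sq_zero _⟩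

/-- `XOm` is the bivector dual to the symplectic form `Om`, i.e. the unique bivector with
`Γ^*(X_Ω) = Ω` where `Γ : V → V*` is the isomorphism induced by `Om`. -/
def IsDualBivector (Om : EForm V) (XOm : ExteriorAlgebra ℝ V) : Prop :=
  XOm ∈ ⋀[ℝ]^2 V ∧ extAlgMap (formToBilin Om) XOm = Om

/-- The pullback action on forms induced by an endomorphism `K : V → V`. -/
def formPullback (K : V →ₗ[ℝ] V) : EForm V →ₐ[ℝ] EForm V :=
  ExteriorAlgebra.lift ℝ ⟨(ExteriorAlgebra.ι ℝ).comp K.dualMap, fun _ => ι_sq_zero _⟩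


theorem iContrL_ι_mul (v : V) (α : Module.Dual ℝ V) (x : EForm V) :
    iContrL v (ι ℝ α * x) = α v • x - ι ℝ α * iContrL v x :=
  CliffordAlgebra.contractLeft_ι_mul _ _ _

theorem iContrL_one (v : V) : iContrL v (1 : EForm V) = 0 :=
  CliffordAlgebra.contractLeft_one _ _

theorem iContrL_ι (v : V) (α : Module.Dual ℝ V) :
    iContrL v (ι ℝ α) = algebraMap ℝ (EForm V) (α v) :=
  CliffordAlgebra.contractLeft_ι _ _ _

theorem iContrL_ι_mul_ι_mul (v : V) (α β : Module.Dual ℝ V) (x : EForm V) :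
    iContrL v (ι ℝ α * ι ℝ β * x) =
      ι ℝ (α v • β - β v • α) * x + ι ℝ α * ι ℝ β * iContrL v x := by
  simp only [mul_assoc, iContrL_ι_mul, map_sub, map_smul, mul_sub, sub_mul, smul_mul_assoc,
    mul_smul_comm]
  abel

theorem aContr_ι (v : V) : aContr (ι ℝ v) = iContrL v := by
  simp [aContr]

theorem extAlgMap_ι (f : V →ₗ[ℝ] Module.Dual ℝ V) (v : V) :
    extAlgMap f (ι ℝ v) = ι ℝ (f v) := by
  simp [extAlgMap]

theorem formToBilin_neg_flip (Om : EForm V) (x y : V) :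
    formToBilin Om x y = -formToBilin Om y x := by
  have h : iContrL y (iContrL x Om) = -iContrL x (iContrL y Om) :=
    CliffordAlgebra.contractLeft_comm _ _ _
  change algebraMapInv (iContrL y (iContrL x Om)) = -algebraMapInv (iContrL x (iContrL y Om))
  rw [h, map_neg]

/-- Every element of `⋀² V` is a finite sum of products of two vectors. -/
theorem exists_sum_ι_mul_ι {X : ExteriorAlgebra ℝ V} (hX : X ∈ ⋀[ℝ]^2 V) :
    ∃ (m : ℕ) (a b : Fin m → V), X = ∑ i, ι ℝ (a i) * ι ℝ (b i) := by
  rw [exteriorPower, pow_two, Submodule.mul_eq_span_mul_set, Submodule.mem_span_set'] at hX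
  obtain ⟨m, c, g, rfl⟩ := hX
  have hg : ∀ i, ∃ a b : V, ι ℝ a * ι ℝ b = (g i : ExteriorAlgebra ℝ V) := by
    intro i
    obtain ⟨_, ⟨a, rfl⟩, _, ⟨b, rfl⟩, h⟩ := (g i).2
    exact ⟨a, b, h⟩
  choose a b hab using hg
  refine ⟨m, fun i => c i • a i, b, Finset.sum_congr rfl fun i _ => ?_⟩
  rw [map_smul, smul_mul_assoc, hab]

/-- A derivation of the algebra of forms which is the identity on 1-forms acts on `k`-forms as
multiplication by `k`. -/
theorem eq_smul_of_derivation (D : Module.End ℝ (EForm V)) (h_one : D 1 = 0)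
    (h_mul : ∀ γ x, D (ι ℝ γ * x) = ι ℝ γ * x + ι ℝ γ * D x)
    {k : ℕ} {x : EForm V} (hx : x ∈ ⋀[ℝ]^k (Module.Dual ℝ V)) : D x = (k : ℝ) • x := by
  induction hx using Submodule.pow_induction_on_left' with
  | algebraMap r => rw [Algebra.algebraMap_eq_smul_one, map_smul, h_one]; simp
  | add x y i _ _ hx hy => rw [map_add, hx, hy, smul_add]
  | mem_mul m hm i x _ hx =>
    obtain ⟨γ, rfl⟩ := hm
    rw [h_mul, hx, mul_smul_comm]
    push_cast
    rw [add_smul, one_smul, add_comm]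

/-- A lowering operator of `sl₂`-type annihilates no nonzero vector of positive weight on which the
raising operator is nilpotent. -/
theorem eq_zero_of_commutator {M : Type*} [AddCommGroup M] [Module ℝ M] (L A : Module.End ℝ M)
    (w : M) {r : ℝ} (hr : 0 < r)
    (hcomm : ∀ m : ℕ, A (L ((L ^ m) w)) = L (A ((L ^ m) w)) + (r + 2 * m) • (L ^ m) w)
    (hA : A w = 0) {N : ℕ} (hN : (L ^ N) w = 0) : w = 0 := by
  have key : ∀ m : ℕ, A ((L ^ (m + 1)) w) = ((m + 1) * (r + m)) • (L ^ m) w := by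
    intro m
    induction m with
    | zero => simpa [hA] using hcomm 0
    | succ m ih =>
      rw [pow_succ' L (m + 1), Module.End.mul_apply, hcomm, ih, map_smul, ← Module.End.mul_apply,
        ← pow_succ', ← add_smul]
      congr 1
      push_cast
      ring
  induction N with
  | zero => simpa using hN
  | succ m ih =>
    refine ih ((smul_eq_zero.mp ((key m).symm.trans (by rw [hN, map_zero]))).resolve_left ?_)
    positivity

section Commutator

variable {m : ℕ} {a b : Fin m → V} {Om : EForm V}

theorem sum_smul_formToBilin
    (hOm : Om = ∑ i, ι ℝ (formToBilin Om (a i)) * ι ℝ (formToBilin Om (b i))) (x : V) :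
    ∑ i, (formToBilin Om (a i) x • formToBilin Om (b i) -
      formToBilin Om (b i) x • formToBilin Om (a i)) = formToBilin Om x := by
  have h : iContrL x Om = ι ℝ (∑ i, (formToBilin Om (a i) x • formToBilin Om (b i) -
      formToBilin Om (b i) x • formToBilin Om (a i))) := by
    conv_lhs => rw [hOm]
    rw [map_sum, map_sum]
    refine Finset.sum_congr rfl fun i _ => ?_
    simpa [iContrL_one] using iContrL_ι_mul_ι_mul x (formToBilin Om (a i)) (formToBilin Om (b i)) 1
  ext y
  change _ = algebraMapInv (iContrL y (iContrL x Om))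
  rw [h, iContrL_ι, algebraMap_leftInverse]

theorem iContrL_mul
    (hOm : Om = ∑ i, ι ℝ (formToBilin Om (a i)) * ι ℝ (formToBilin Om (b i)))
    (x : V) (w : EForm V) :
    iContrL x (Om * w) = ι ℝ (formToBilin Om x) * w + Om * iContrL x w := by
  have h : iContrL x ((∑ i, ι ℝ (formToBilin Om (a i)) * ι ℝ (formToBilin Om (b i))) * w) =
      ι ℝ (∑ i, (formToBilin Om (a i) x • formToBilin Om (b i) -
        formToBilin Om (b i) x • formToBilin Om (a i))) * w +
      (∑ i, ι ℝ (formToBilin Om (a i)) * ι ℝ (formToBilin Om (b i))) * iContrL x w := by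
    simp only [Finset.sum_mul, map_sum, iContrL_ι_mul_ι_mul, Finset.sum_add_distrib]
  rwa [sum_smul_formToBilin hOm, ← hOm] at h

/-- The nondegeneracy of `Om` turns the duality of `∑ aᵢ ∧ bᵢ` and `Om` into a resolution of the
identity. -/
theorem sum_smul_sub_smul
    (hOm : Om = ∑ i, ι ℝ (formToBilin Om (a i)) * ι ℝ (formToBilin Om (b i)))
    (hinj : Function.Injective (formToBilin Om)) (x : V) :
    ∑ i, (formToBilin Om x (b i) • a i - formToBilin Om x (a i) • b i) = x := by
  apply hinj
  conv_rhs => rw [← sum_smul_formToBilin hOm x]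
  rw [map_sum]
  refine Finset.sum_congr rfl fun i _ => ?_
  rw [map_sub, map_smul, map_smul, formToBilin_neg_flip Om x, formToBilin_neg_flip Om x]
  module

theorem injective_formToBilin (h : IsSymplecticForm Om) :
    Function.Injective (formToBilin Om) :=
  (injective_iff_map_eq_zero _).mpr fun x hx => h.2 x fun y => by rw [hx]; rfl

theorem sum_formToBilin [FiniteDimensional ℝ V]
    (hOm : Om = ∑ i, ι ℝ (formToBilin Om (a i)) * ι ℝ (formToBilin Om (b i)))
    (hinj : Function.Injective (formToBilin Om)) :
    2 * ∑ i, formToBilin Om (a i) (b i) = Module.finrank ℝ V := by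
  have hid : ∑ i, (((formToBilin Om).flip (b i)).smulRight (a i) -
      ((formToBilin Om).flip (a i)).smulRight (b i)) = LinearMap.id := by
    ext x
    simpa using sum_smul_sub_smul hOm hinj x
  rw [← LinearMap.trace_id, ← hid, map_sum, Finset.mul_sum]
  refine Finset.sum_congr rfl fun i _ => ?_
  rw [map_sub, LinearMap.trace_smulRight, LinearMap.trace_smulRight, LinearMap.flip_apply,
    LinearMap.flip_apply, formToBilin_neg_flip Om (b i)]
  ring

theorem sum_wedge_iContrL [FiniteDimensional ℝ V]
    (hOm : Om = ∑ i, ι ℝ (formToBilin Om (a i)) * ι ℝ (formToBilin Om (b i)))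
    (hinj : Function.Injective (formToBilin Om))
    {k : ℕ} {w : EForm V} (hw : w ∈ ⋀[ℝ]^k (Module.Dual ℝ V)) :
    ∑ i, (ι ℝ (formToBilin Om (a i)) * iContrL (b i) w -
      ι ℝ (formToBilin Om (b i)) * iContrL (a i) w) = (k : ℝ) • w := by
  have hsurj : Function.Surjective (formToBilin Om) :=
    (LinearMap.injective_iff_surjective_of_finrank_eq_finrank
      (Subspace.dual_finrank_eq (K := ℝ) (V := V)).symm).mp hinj
  let D : Module.End ℝ (EForm V) :=
    ∑ i, (LinearMap.mulLeft ℝ (ι ℝ (formToBilin Om (a i))) ∘ₗ iContrL (b i) -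
      LinearMap.mulLeft ℝ (ι ℝ (formToBilin Om (b i))) ∘ₗ iContrL (a i))
  have hD : ∀ x, D x = ∑ i, (ι ℝ (formToBilin Om (a i)) * iContrL (b i) x -
      ι ℝ (formToBilin Om (b i)) * iContrL (a i) x) := fun x => by
    simp [D, LinearMap.sum_apply]
  rw [← hD]
  refine eq_smul_of_derivation D (by simp [hD, iContrL_one]) (fun γ x => ?_) hw
  obtain ⟨v, rfl⟩ := hsurj γ
  have hv : ι ℝ (formToBilin Om v) * x =
      ∑ i, (formToBilin Om v (b i) • (ι ℝ (formToBilin Om (a i)) * x) -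
        formToBilin Om v (a i) • (ι ℝ (formToBilin Om (b i)) * x)) := by
    conv_lhs => rw [← sum_smul_sub_smul hOm hinj v]
    simp only [map_sum, map_sub, map_smul, Finset.sum_mul, sub_mul, smul_mul_assoc]
  have hanti : ∀ (α β : Module.Dual ℝ V) (y : EForm V),
      ι ℝ α * (ι ℝ β * y) = -(ι ℝ β * (ι ℝ α * y)) := fun α β y => by
    rw [← mul_assoc, ← mul_assoc, ← neg_mul,
      eq_neg_of_add_eq_zero_left (ι_add_mul_swap α β)]
  rw [hD]
  conv_rhs => rw [hv, hD, Finset.mul_sum, ← Finset.sum_add_distrib]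
  refine Finset.sum_congr rfl fun i _ => ?_
  rw [iContrL_ι_mul, iContrL_ι_mul, mul_sub, mul_sub, mul_sub, mul_smul_comm, mul_smul_comm,
    hanti (formToBilin Om (a i)), hanti (formToBilin Om (b i))]
  abel

/-- The commutation relation between contraction by the dual bivector and exterior multiplication
by the symplectic form. -/
theorem aContr_mul [FiniteDimensional ℝ V]
    (hOm : Om = ∑ i, ι ℝ (formToBilin Om (a i)) * ι ℝ (formToBilin Om (b i)))
    (hinj : Function.Injective (formToBilin Om)) {n k : ℕ} (hdim : Module.finrank ℝ V = 2 * n)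
    {w : EForm V} (hw : w ∈ ⋀[ℝ]^k (Module.Dual ℝ V)) :
    aContr (∑ i, ι ℝ (a i) * ι ℝ (b i)) (Om * w) =
      Om * aContr (∑ i, ι ℝ (a i) * ι ℝ (b i)) w + ((k : ℝ) - n) • w := by
  have hA : ∀ x, aContr (∑ i, ι ℝ (a i) * ι ℝ (b i)) x = ∑ i, iContrL (a i) (iContrL (b i) x) :=
    fun x => by simp [aContr_ι, LinearMap.sum_apply]
  have htr : ∑ i, formToBilin Om (a i) (b i) = n := by
    have := sum_formToBilin hOm hinj
    rw [hdim] at this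
    push_cast at this
    linarith
  rw [hA, hA, sub_smul, ← sum_wedge_iContrL hOm hinj hw, ← htr, Finset.sum_smul,
    ← Finset.sum_sub_distrib, Finset.mul_sum, ← Finset.sum_add_distrib]
  refine Finset.sum_congr rfl fun i _ => ?_
  rw [iContrL_mul hOm, map_add, iContrL_mul hOm, iContrL_ι_mul, formToBilin_neg_flip Om (b i),
    neg_smul]
  abel

end Commutator

theorem eq_zero_of_finrank_lt [FiniteDimensional ℝ V] {k : ℕ} (hk : Module.finrank ℝ V < k)
    {w : EForm V} (hw : w ∈ ⋀[ℝ]^k (Module.Dual ℝ V)) : w = 0 := by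
  have h : Module.finrank ℝ (⋀[ℝ]^k (Module.Dual ℝ V)) = 0 := by
    rw [exteriorPower.finrank_eq, Subspace.dual_finrank_eq, Nat.choose_eq_zero_of_lt hk]
  exact (Submodule.eq_bot_iff _).mp (Submodule.finrank_eq_zero.mp h) w hw

/-- On a symplectic vector space `(V, Ω)` of dimension `2n`, the contraction map
`⊥ : Λᵏ(V*) → Λᵏ⁻²(V*)`, `ω ↦ i_{X_Ω} ω`, is injective for `k ≥ n + 1`. -/
theorem bot_injective [FiniteDimensional ℝ V] (n k : ℕ)
    (hdim : Module.finrank ℝ V = 2 * n)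
    (Om : EForm V) (hOm : IsSymplecticForm Om)
    (XOm : ExteriorAlgebra ℝ V) (hX : IsDualBivector Om XOm)
    (hk : n + 1 ≤ k)
    (ω : EForm V) (hω : ω ∈ ⋀[ℝ]^k (Module.Dual ℝ V))
    (h : aContr XOm ω = 0) : ω = 0 := by
  obtain ⟨m, a, b, rfl⟩ := exists_sum_ι_mul_ι hX.1
  have hsum : Om = ∑ i, ι ℝ (formToBilin Om (a i)) * ι ℝ (formToBilin Om (b i)) := by
    conv_lhs => rw [← hX.2]
    simp only [map_sum, map_mul, extAlgMap_ι]
  have hmem : ∀ j : ℕ, (LinearMap.mulLeft ℝ Om ^ j) ω ∈ ⋀[ℝ]^(2 * j + k) (Module.Dual ℝ V) := by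
    intro j
    rw [LinearMap.pow_mulLeft, LinearMap.mulLeft_apply, exteriorPower, pow_add, pow_mul]
    exact Submodule.mul_mem_mul (Submodule.pow_mem_pow _ hOm.1 j) hω
  have hr : (0 : ℝ) < k - n := sub_pos.mpr (by exact_mod_cast hk)
  refine eq_zero_of_commutator (LinearMap.mulLeft ℝ Om) (aContr _) ω hr (fun j => ?_) h
    (N := n) (eq_zero_of_finrank_lt (by omega) (hmem n))
  rw [LinearMap.mulLeft_apply, LinearMap.mulLeft_apply,
    aContr_mul hsum (injective_formToBilin hOm) hdim (hmem j)]
  congr 2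
  push_cast
  ring
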